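/- Σ_{n=0}^∞ U(n,−3/4) · R(n,−3/4) · (1/64)^n = π² + 8·Σ_{k=0}^∞ (−1)^k/(2k+1)², where U(n,x) = (1)_n³ (1+x)_n² / [(1/2)_n · (1/2 + x/2)_n² · (1 + x/2)_n²] and R(n,x) = (21n³ + 55n² + 47n + 13 + 2x³ + 13x²n + 28xn² + 11x² + 48xn + 20x) / (2(2n+x+1)²(2n+1)(2n+x+2)²). -/

import Mathlib

open Real

/-- The Pochhammer symbol (rising factorial): `poch a n = a (a+1) ⋯ (a+n-1)`. -/
noncomputable def poch (a : ℝ) (n : ℕ) : ℝ := (ascPochhammer ℝ n).eval a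

/-- `U(n,x)` of the accelerated series for `ζ(2,1+x)`. -/
noncomputable def Uacc2 (n : ℕ) (x : ℝ) : ℝ :=
  (poch 1 n) ^ 3 * (poch (1 + x) n) ^ 2 /
    (poch (1 / 2) n * (poch (1 / 2 + x / 2) n) ^ 2 * (poch (1 + x / 2) n) ^ 2)

/-- `R(n,x)` of the accelerated series for `ζ(2,1+x)`. -/
noncomputable def Racc2 (n : ℕ) (x : ℝ) : ℝ :=
  (21 * (n : ℝ) ^ 3 + 55 * (n : ℝ) ^ 2 + 47 * (n : ℝ) + 13 + 2 * x ^ 3 +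
      13 * x ^ 2 * (n : ℝ) + 28 * x * (n : ℝ) ^ 2 + 11 * x ^ 2 + 48 * x * (n : ℝ) +
      20 * x) /
    (2 * (2 * (n : ℝ) + x + 1) ^ 2 * (2 * (n : ℝ) + 1) * (2 * (n : ℝ) + x + 2) ^ 2)

open Filter Topology

theorem poch_succ (a : ℝ) (n : ℕ) : poch a (n + 1) = poch a n * (a + n) := by
  simp [poch, ascPochhammer_succ_eval]

theorem poch_pos {a : ℝ} (ha : 0 < a) (n : ℕ) : 0 < poch a n := ascPochhammer_pos n a ha

theorem Uacc2_zero (x : ℝ) : Uacc2 0 x = 1 := by simp [Uacc2, poch]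

theorem Uacc2_pos {x : ℝ} (hx : -1 < x) (n : ℕ) : 0 < Uacc2 n x := by
  have h₁ := poch_pos (a := 1) (by norm_num) n
  have h₂ := poch_pos (a := 1 + x) (by linarith) n
  have h₃ := poch_pos (a := 1 / 2) (by norm_num) n
  have h₄ := poch_pos (a := 1 / 2 + x / 2) (by linarith) n
  have h₅ := poch_pos (a := 1 + x / 2) (by linarith) n
  unfold Uacc2
  positivity

theorem Uacc2_succ {x : ℝ} (hx : -1 < x) (n : ℕ) :
    Uacc2 (n + 1) x = Uacc2 n x * (32 * (n + 1) ^ 3 * (n + 1 + x) ^ 2 /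
      ((2 * n + 1) * (2 * n + 1 + x) ^ 2 * (2 * n + 2 + x) ^ 2)) := by
  have h₃ := (poch_pos (a := 1 / 2) (by norm_num) n).ne'
  have h₄ := (poch_pos (a := 1 / 2 + x / 2) (by linarith) n).ne'
  have h₅ := (poch_pos (a := 1 + x / 2) (by linarith) n).ne'
  have hn : (0 : ℝ) ≤ n := n.cast_nonneg
  have d₁ : (2 * n + 1 : ℝ) ≠ 0 := by positivity
  have d₂ : (2 * n + 1 + x : ℝ) ≠ 0 := by linarith
  have d₃ : (2 * n + 2 + x : ℝ) ≠ 0 := by linarith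
  have e₁ : (1 / 2 + n : ℝ) = (2 * n + 1) / 2 := by ring
  have e₂ : (1 / 2 + x / 2 + n : ℝ) = (2 * n + 1 + x) / 2 := by ring
  have e₃ : (1 + x / 2 + n : ℝ) = (2 * n + 2 + x) / 2 := by ring
  simp only [Uacc2, poch_succ, e₁, e₂, e₃]
  generalize poch (1 / 2) n = a at *
  generalize poch (1 / 2 + x / 2) n = b at *
  generalize poch (1 + x / 2) n = c at *
  field_simp
  ring

theorem Uacc2_add_one {x : ℝ} (hx : -1 < x) (n : ℕ) :
    Uacc2 n (x + 1) = Uacc2 n x * ((n + 1 + x) ^ 2 / (2 * n + 1 + x) ^ 2) := by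
  induction n with
  | zero =>
    have : 1 + x ≠ 0 := by linarith
    simp [Uacc2_zero, this]
  | succ n ih =>
    have hn : (0 : ℝ) ≤ n := n.cast_nonneg
    rw [Uacc2_succ (by linarith), ih, Uacc2_succ hx]
    push_cast
    have d₁ : (2 * n + 1 : ℝ) ≠ 0 := by positivity
    have d₂ : (2 * n + 1 + x : ℝ) ≠ 0 := by linarith
    have d₃ : (2 * n + 2 + x : ℝ) ≠ 0 := by linarith
    have d₄ : (2 * n + 3 + x : ℝ) ≠ 0 := by linarith
    rw [show (2 * n + 1 + (x + 1) : ℝ) = 2 * n + 2 + x by ring,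
      show (2 * n + 2 + (x + 1) : ℝ) = 2 * n + 3 + x by ring,
      show (2 * (n + 1) + 1 + x : ℝ) = 2 * n + 3 + x by ring]
    field_simp
    ring

/-- The general term of the accelerated series for `ζ(2,1+x)`. -/
noncomputable def accTerm (x : ℝ) (n : ℕ) : ℝ := Uacc2 n x * Racc2 n x * (1 / 64 : ℝ) ^ n

/-- The companion of `accTerm` in its Wilf–Zeilberger pair. -/
noncomputable def accMate (x : ℝ) (n : ℕ) : ℝ :=
  Uacc2 n x * (1 / 64 : ℝ) ^ n / (2 * n + 1 + x) ^ 2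

theorem accTerm_sub_accTerm_add_one {x : ℝ} (hx : -1 < x) (n : ℕ) :
    accTerm x n - accTerm (x + 1) n = accMate x n - accMate x (n + 1) := by
  have hn : (0 : ℝ) ≤ n := n.cast_nonneg
  simp only [accTerm, accMate, Uacc2_add_one hx, Uacc2_succ hx, Racc2, pow_succ (1 / 64 : ℝ)]
  push_cast
  generalize (1 / 64 : ℝ) ^ n = q
  generalize Uacc2 n x = u
  obtain ⟨a, rfl⟩ : ∃ a, x = a - 1 - 2 * n := ⟨x + 1 + 2 * n, by ring⟩
  have ha : 0 < a := by linarith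
  rw [show (2 * n + (a - 1 - 2 * n) + 1 : ℝ) = a by ring,
    show (2 * n + 1 + (a - 1 - 2 * n) : ℝ) = a by ring,
    show (2 * n + (a - 1 - 2 * n) + 2 : ℝ) = a + 1 by ring,
    show (2 * n + 2 + (a - 1 - 2 * n) : ℝ) = a + 1 by ring,
    show (2 * n + (a - 1 - 2 * n + 1) + 1 : ℝ) = a + 1 by ring,
    show (2 * n + (a - 1 - 2 * n + 1) + 2 : ℝ) = a + 2 by ring,
    show (2 * (n + 1) + 1 + (a - 1 - 2 * n) : ℝ) = a + 2 by ring]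
  field_simp
  ring

theorem Uacc2_mul_pow_le {x : ℝ} (hx : -1 < x) (n : ℕ) :
    Uacc2 n x * (1 / 64 : ℝ) ^ n ≤ (1 / 2) ^ n := by
  induction n with
  | zero => simp [Uacc2_zero]
  | succ n ih =>
    obtain ⟨y, rfl⟩ : ∃ y, x = y - 1 := ⟨x + 1, by ring⟩
    have hy : 0 < y := by linarith
    have hn : (0 : ℝ) ≤ n := n.cast_nonneg
    have ratio : 32 * (n + 1 : ℝ) ^ 3 * (n + 1 + (y - 1)) ^ 2 /
        ((2 * n + 1) * (2 * n + 1 + (y - 1)) ^ 2 * (2 * n + 2 + (y - 1)) ^ 2) ≤ 32 := by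
      rw [show (n + 1 + (y - 1) : ℝ) = n + y by ring,
        show (2 * n + 1 + (y - 1) : ℝ) = 2 * n + y by ring,
        show (2 * n + 2 + (y - 1) : ℝ) = 2 * n + 1 + y by ring]
      have key : (n + 1 : ℝ) * (n + 1) ^ 2 * (n + y) ^ 2 ≤
          (2 * n + 1) * (2 * n + 1 + y) ^ 2 * (2 * n + y) ^ 2 := by
        have h₁ : (n + 1 : ℝ) ≤ 2 * n + 1 := by linarith
        have h₂ : (n + 1 : ℝ) ≤ 2 * n + 1 + y := by linarith
        have h₃ : (n + y : ℝ) ≤ 2 * n + y := by linarith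
        gcongr
      rw [div_le_iff₀ (by positivity)]
      linarith
    rw [Uacc2_succ hx, pow_succ, pow_succ]
    calc _ = Uacc2 n (y - 1) * (1 / 64) ^ n * (32 * (n + 1 : ℝ) ^ 3 * (n + 1 + (y - 1)) ^ 2 /
        ((2 * n + 1) * (2 * n + 1 + (y - 1)) ^ 2 * (2 * n + 2 + (y - 1)) ^ 2)) * (1 / 64) := by
          ring
      _ ≤ (1 / 2) ^ n * 32 * (1 / 64) := by gcongr
      _ = _ := by ring

theorem Racc2_nonneg {x : ℝ} (hx : -1 < x) (n : ℕ) : 0 ≤ Racc2 n x := by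
  obtain ⟨y, rfl⟩ : ∃ y, x = y - 1 := ⟨x + 1, by ring⟩
  have hy : 0 < y := by linarith
  have hn : (0 : ℝ) ≤ n := n.cast_nonneg
  unfold Racc2
  refine div_nonneg ?_ (by positivity)
  ring_nf
  positivity

theorem Racc2_le {x : ℝ} (hx : -3 / 4 ≤ x) (n : ℕ) : Racc2 n x ≤ 100 / (1 + x) := by
  obtain ⟨z, rfl⟩ : ∃ z, x = z - 3 / 4 := ⟨x + 3 / 4, by ring⟩
  have hz : 0 ≤ z := by linarith
  have hn : (0 : ℝ) ≤ n := n.cast_nonneg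
  unfold Racc2
  rw [show (2 * n + (z - 3 / 4) + 1 : ℝ) = 2 * n + z + 1 / 4 by ring,
    show (2 * n + (z - 3 / 4) + 2 : ℝ) = 2 * n + z + 5 / 4 by ring,
    show (1 + (z - 3 / 4) : ℝ) = z + 1 / 4 by ring,
    div_le_div_iff₀ (by positivity) (by positivity), ← sub_nonneg]
  ring_nf
  positivity

theorem accTerm_nonneg {x : ℝ} (hx : -1 < x) (n : ℕ) : 0 ≤ accTerm x n :=
  mul_nonneg (mul_nonneg (Uacc2_pos hx n).le (Racc2_nonneg hx n)) (by positivity)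

theorem accTerm_le {x : ℝ} (hx : -3 / 4 ≤ x) (n : ℕ) :
    accTerm x n ≤ (1 / 2) ^ n * (100 / (1 + x)) := by
  have hx' : -1 < x := by linarith
  calc accTerm x n = Uacc2 n x * (1 / 64 : ℝ) ^ n * Racc2 n x := by unfold accTerm; ring
    _ ≤ _ := mul_le_mul (Uacc2_mul_pow_le hx' n) (Racc2_le hx n) (Racc2_nonneg hx' n)
      (by positivity)

theorem summable_accTerm {x : ℝ} (hx : -3 / 4 ≤ x) : Summable (accTerm x) :=
  .of_nonneg_of_le (accTerm_nonneg (by linarith)) (accTerm_le hx)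
    (summable_geometric_two.mul_right _)

theorem tsum_accTerm_le {x : ℝ} (hx : -3 / 4 ≤ x) : ∑' n, accTerm x n ≤ 200 / (1 + x) := by
  refine ((summable_accTerm hx).tsum_le_tsum (accTerm_le hx)
    (summable_geometric_two.mul_right _)).trans_eq ?_
  rw [tsum_mul_right, tsum_geometric_two]
  ring

theorem tendsto_accMate {x : ℝ} (hx : -1 < x) : Tendsto (accMate x) atTop (𝓝 0) := by
  have hx' : 0 < 1 + x := by linarith
  have hlim : Tendsto (fun n : ℕ => (1 / 2 : ℝ) ^ n / (1 + x) ^ 2) atTop (𝓝 0) := by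
    simpa using (tendsto_pow_atTop_nhds_zero_of_lt_one (r := (1 / 2 : ℝ)) (by norm_num)
      (by norm_num)).div_const ((1 + x) ^ 2)
  refine squeeze_zero (fun n => ?_) (fun n => ?_) hlim
  · have := Uacc2_pos hx n
    unfold accMate
    positivity
  · have hn : (0 : ℝ) ≤ n := n.cast_nonneg
    exact div_le_div₀ (by positivity) (Uacc2_mul_pow_le hx n) (by positivity)
      (pow_le_pow_left₀ hx'.le (by linarith) 2)

theorem tsum_accTerm_sub {x : ℝ} (hx : -3 / 4 ≤ x) :
    ∑' n, accTerm x n - ∑' n, accTerm (x + 1) n = 1 / (1 + x) ^ 2 := by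
  have hx' : -1 < x := by linarith
  have h := ((summable_accTerm hx).hasSum.sub
    (summable_accTerm (x := x + 1) (by linarith)).hasSum).tendsto_sum_nat
  simp only [accTerm_sub_accTerm_add_one hx', Finset.sum_range_sub'] at h
  refine tendsto_nhds_unique h ?_
  simpa [accMate, Uacc2_zero] using (tendsto_accMate hx').const_sub (accMate x 0)

theorem sum_range_one_div_sq {x : ℝ} (hx : -3 / 4 ≤ x) (N : ℕ) :
    ∑ k ∈ Finset.range N, 1 / (k + 1 + x) ^ 2 =
      ∑' n, accTerm x n - ∑' n, accTerm (x + N) n := by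
  induction N with
  | zero => simp
  | succ N ih =>
    have hN : (0 : ℝ) ≤ N := N.cast_nonneg
    have h := tsum_accTerm_sub (x := x + N) (by linarith)
    rw [Finset.sum_range_succ, ih, show (N + 1 + x : ℝ) = 1 + (x + N) by ring, ← h,
      Nat.cast_succ, ← add_assoc]
    ring

/-- The accelerated series sums to the Hurwitz zeta value `ζ(2,1+x)`. -/
theorem hasSum_one_div_sq_accTerm {x : ℝ} (hx : -3 / 4 ≤ x) :
    HasSum (fun k : ℕ => 1 / (k + 1 + x) ^ 2) (∑' n, accTerm x n) := by
  rw [hasSum_iff_tendsto_nat_of_nonneg (fun k => by positivity)]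
  simp only [sum_range_one_div_sq hx]
  have hbound : Tendsto (fun N : ℕ => 200 / (1 + (x + N))) atTop (𝓝 0) :=
    tendsto_const_nhds.div_atTop (tendsto_atTop_add_const_left _ _
      (tendsto_atTop_add_const_left _ _ tendsto_natCast_atTop_atTop))
  have hx' (N : ℕ) : -3 / 4 ≤ x + N := by
    have hN : (0 : ℝ) ≤ N := N.cast_nonneg
    linarith
  have hlim : Tendsto (fun N : ℕ => ∑' n, accTerm (x + N) n) atTop (𝓝 0) :=
    squeeze_zero (fun N => tsum_nonneg (accTerm_nonneg (by linarith [hx' N])))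
      (fun N => tsum_accTerm_le (hx' N)) hbound
  simpa using hlim.const_sub (∑' n, accTerm x n)

theorem hasSum_one_div_odd_sq :
    HasSum (fun k : ℕ => 1 / (2 * (k : ℝ) + 1) ^ 2) (π ^ 2 / 8) := by
  have heven : HasSum (fun k : ℕ => 1 / (((2 * k : ℕ) : ℝ)) ^ 2) (π ^ 2 / 24) := by
    convert! hasSum_zeta_two.mul_left (1 / 4) using 1
    · ext k
      push_cast
      ring
    · ring
  have hodd : Summable (fun k : ℕ => 1 / (((2 * k + 1 : ℕ) : ℝ)) ^ 2) :=
    hasSum_zeta_two.summable.comp_injective (i := fun k : ℕ => 2 * k + 1)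
      (fun a b h => by simpa using h)
  have h := (heven.even_add_odd (f := fun n : ℕ => 1 / (n : ℝ) ^ 2) hodd.hasSum).unique
    hasSum_zeta_two
  convert! hodd.hasSum using 1
  · simp
  · linarith

theorem hasSum_one_div_quarter_sq :
    HasSum (fun k : ℕ => 1 / (k + 1 + (-3 / 4 : ℝ)) ^ 2)
      (π ^ 2 + 8 * ∑' k : ℕ, (-1 : ℝ) ^ k / (2 * (k : ℝ) + 1) ^ 2) := by
  have hcat : Summable (fun k : ℕ => (-1 : ℝ) ^ k / (2 * (k : ℝ) + 1) ^ 2) :=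
    .of_norm_bounded hasSum_one_div_odd_sq.summable fun k => by simp
  have hadd := (hasSum_one_div_odd_sq.add hcat.hasSum).mul_left 8
  have hsum : Summable (fun k : ℕ => 1 / (k + 1 + (-3 / 4 : ℝ)) ^ 2) :=
    (hasSum_one_div_sq_accTerm le_rfl).summable
  have h := HasSum.even_add_odd (f := fun k : ℕ => 8 * (1 / (2 * (k : ℝ) + 1) ^ 2 +
    (-1 : ℝ) ^ k / (2 * (k : ℝ) + 1) ^ 2)) (m := ∑' k : ℕ, 1 / (k + 1 + (-3 / 4 : ℝ)) ^ 2)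
    (m' := 0) ?_ ?_
  · convert! hsum.hasSum using 1
    linarith [h.unique hadd]
  · convert! hsum.hasSum using 1
    ext k
    have d : (4 * k + 1 : ℝ) ≠ 0 := by positivity
    rw [show (k + 1 + (-3 / 4) : ℝ) = (4 * k + 1) / 4 by ring]
    push_cast
    rw [pow_mul, show (2 * (2 * k) + 1 : ℝ) = 4 * k + 1 by ring]
    field_simp
    norm_num
  · convert! hasSum_zero using 1
    ext k
    rw [Odd.neg_one_pow ⟨k, rfl⟩]
    ring

theorem zeta2_quarter_fast_series :
    ∑' n : ℕ, Uacc2 n (-3 / 4) * Racc2 n (-3 / 4) * (1 / 64 : ℝ) ^ n =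
      π ^ 2 + 8 * ∑' k : ℕ, (-1 : ℝ) ^ k / (2 * (k : ℝ) + 1) ^ 2 := by
  exact (hasSum_one_div_sq_accTerm le_rfl).unique hasSum_one_div_quarter_sq
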